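/- Every harmonic homogeneous polynomial p of degree 4 on ℝ³ can be factorized as a harmonic product of two second-order deviators: there exist traceless symmetric real 3×3 matrices h₁ and h₂ such that for all x ∈ ℝ³, p(x) = (xᵀh₁x)(xᵀh₂x) − (2/7)‖x‖² xᵀ(h₁h₂ + h₂h₁)x + (2/35)tr(h₁h₂)‖x‖⁴. -/

import Mathlib

open MvPolynomial Matrix

/-- The Laplacian of a polynomial in three variables. -/
noncomputable def lap3 (p : MvPolynomial (Fin 3) ℝ) : MvPolynomial (Fin 3) ℝ :=
  ∑ i : Fin 3, pderiv i (pderiv i p)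

/-- The antipodal conjugate of a complex polynomial `f` of formal degree `N`, namely
`z ^ N * conj (f (-1 / conj z))`. -/
noncomputable def antipodal (N : ℕ) (f : Polynomial ℂ) : Polynomial ℂ :=
  Polynomial.reflect N ((f.map (starRingEnd ℂ)).comp (-Polynomial.X))

theorem natDegree_map_conj_comp_neg_X (f : Polynomial ℂ) :
    ((f.map (starRingEnd ℂ)).comp (-Polynomial.X)).natDegree = f.natDegree := by
  simp [Polynomial.natDegree_comp, Polynomial.natDegree_map]

theorem coeff_antipodal {N k : ℕ} (hk : k ≤ N) (f : Polynomial ℂ) :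
    (antipodal N f).coeff k = (-1) ^ (N - k) * starRingEnd ℂ (f.coeff (N - k)) := by
  rw [antipodal, Polynomial.coeff_reflect, Polynomial.revAt_le hk,
    show (-Polynomial.X : Polynomial ℂ) = Polynomial.C (-1) * Polynomial.X by simp,
    Polynomial.comp_C_mul_X_coeff, Polynomial.coeff_map, mul_comm]

theorem antipodal_mul {M N : ℕ} {f g : Polynomial ℂ} (hf : f.natDegree ≤ M)
    (hg : g.natDegree ≤ N) : antipodal (M + N) (f * g) = antipodal M f * antipodal N g := by
  rw [antipodal, Polynomial.map_mul, Polynomial.mul_comp, Polynomial.reflect_mul]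
  · rfl
  · rwa [natDegree_map_conj_comp_neg_X]
  · rwa [natDegree_map_conj_comp_neg_X]

theorem antipodal_X_sub_C (w : ℂ) : antipodal 1 (Polynomial.X - Polynomial.C w) =
    -(1 + Polynomial.C (starRingEnd ℂ w) * Polynomial.X) := by
  simp [antipodal, Polynomial.reflect_sub, Polynomial.reflect_neg]
  ring

/-- A polynomial of formal degree `2 * n` whose roots form antipodal pairs. -/
structure IsAntipodal (n : ℕ) (f : Polynomial ℂ) : Prop where
  natDegree_le : f.natDegree ≤ 2 * n
  antipodal_eq : antipodal (2 * n) f = f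

theorem IsAntipodal.coeff_eq {n k : ℕ} {f : Polynomial ℂ} (hf : IsAntipodal n f)
    (hk : k ≤ 2 * n) :
    f.coeff k = (-1) ^ (2 * n - k) * starRingEnd ℂ (f.coeff (2 * n - k)) := by
  rw [← coeff_antipodal hk, hf.antipodal_eq]

theorem isAntipodal_of_coeff {n : ℕ} {f : Polynomial ℂ} (hd : f.natDegree ≤ 2 * n)
    (h : ∀ k ≤ 2 * n, f.coeff k = (-1) ^ (2 * n - k) * starRingEnd ℂ (f.coeff (2 * n - k))) :
    IsAntipodal n f := by
  refine ⟨hd, Polynomial.ext fun k => ?_⟩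
  rcases le_or_gt k (2 * n) with hk | hk
  · rw [coeff_antipodal hk, ← h k hk]
  · rw [antipodal, Polynomial.coeff_reflect, Polynomial.revAt_eq_self_of_lt hk,
      Polynomial.coeff_eq_zero_of_natDegree_lt (hd.trans_lt hk),
      Polynomial.coeff_eq_zero_of_natDegree_lt]
    rw [natDegree_map_conj_comp_neg_X]
    exact hd.trans_lt hk

theorem IsAntipodal.mul {m n : ℕ} {f g : Polynomial ℂ} (hf : IsAntipodal m f)
    (hg : IsAntipodal n g) : IsAntipodal (m + n) (f * g) where
  natDegree_le := by
    have := Polynomial.natDegree_mul_le (p := f) (q := g)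
    have := hf.natDegree_le
    have := hg.natDegree_le
    omega
  antipodal_eq := by
    rw [mul_add, antipodal_mul hf.natDegree_le hg.natDegree_le, hf.antipodal_eq, hg.antipodal_eq]

/-- The antipodal quadratic with roots `w` and `-1 / conj w`. -/
theorem isAntipodal_quadratic (w : ℂ) : IsAntipodal 1 (Polynomial.C Complex.I *
    ((Polynomial.X - Polynomial.C w) *
      (1 + Polynomial.C (starRingEnd ℂ w) * Polynomial.X))) := by
  have e : Polynomial.C Complex.I * ((Polynomial.X - Polynomial.C w) *
      (1 + Polynomial.C (starRingEnd ℂ w) * Polynomial.X)) =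
      Polynomial.C (Complex.I * starRingEnd ℂ w) * Polynomial.X ^ 2 +
      Polynomial.C (Complex.I * (1 - w * starRingEnd ℂ w)) * Polynomial.X +
      Polynomial.C (-Complex.I * w) := by
    simp only [Polynomial.C_mul, Polynomial.C_sub, Polynomial.C_neg, Polynomial.C_1]
    ring
  rw [e]
  refine isAntipodal_of_coeff (by compute_degree) fun k hk => ?_
  interval_cases k <;>
    simp [Polynomial.coeff_X, Polynomial.coeff_C, Polynomial.coeff_X_pow, -map_mul] <;> simp [mul_comm]

theorem IsAntipodal.exists_eq_mul {n : ℕ} {f : Polynomial ℂ} (hf : IsAntipodal (n + 1) f) :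
    ∃ q g, IsAntipodal 1 q ∧ IsAntipodal n g ∧ f = q * g := by
  have hzero : ∀ m, IsAntipodal m 0 := fun m => isAntipodal_of_coeff (by simp) (by simp)
  rcases eq_or_ne f 0 with rfl | hf0
  · exact ⟨0, 0, hzero 1, hzero n, by simp⟩
  have htop : f.coeff 0 = 0 → f.natDegree ≤ 2 * n + 1 := by
    intro h0
    have h := hf.coeff_eq (k := 2 * (n + 1)) le_rfl
    rw [Nat.sub_self, h0] at h
    by_contra hlt
    have hd : f.natDegree = 2 * (n + 1) := by have := hf.natDegree_le; omega
    rw [← hd] at h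
    exact hf0 (Polynomial.leadingCoeff_eq_zero.mp (by simpa using h))
  have hdeg : f.degree ≠ 0 := by
    intro hd
    rw [Polynomial.eq_C_of_degree_eq_zero hd] at hf0
    have h := hf.coeff_eq (k := 0) (Nat.zero_le _)
    rw [Nat.sub_zero, Polynomial.coeff_eq_zero_of_natDegree_lt (n := 2 * (n + 1))] at h
    · simp [h] at hf0
    · rw [Polynomial.natDegree_eq_zero_iff_degree_le_zero.mpr hd.le]; omega
  obtain ⟨w, hw⟩ := IsAlgClosed.exists_root f hdeg
  obtain ⟨g, hg⟩ := Polynomial.dvd_iff_isRoot.mpr hw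
  have hXw := Polynomial.X_sub_C_ne_zero w
  have hg0 : g ≠ 0 := by rintro rfl; simp [hg] at hf0
  have hgd : g.natDegree ≤ 2 * n + 1 := by
    have h := hf.natDegree_le
    rw [hg, Polynomial.natDegree_mul hXw hg0, Polynomial.natDegree_X_sub_C] at h
    omega
  have hdvd : (1 + Polynomial.C (starRingEnd ℂ w) * Polynomial.X) ∣ f := by
    have h := antipodal_mul (M := 1) (Polynomial.natDegree_X_sub_C_le w) hgd
    rw [← hg, show 1 + (2 * n + 1) = 2 * (n + 1) by ring, hf.antipodal_eq,
      antipodal_X_sub_C] at h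
    exact ⟨-antipodal (2 * n + 1) g, by rw [h]; ring⟩
  have hcop : IsCoprime (1 + Polynomial.C (starRingEnd ℂ w) * Polynomial.X)
      (Polynomial.X - Polynomial.C w) := by
    have hne : 1 + Complex.normSq w ≠ 0 := by
      have := Complex.normSq_nonneg w
      positivity
    have hne' : (1 + starRingEnd ℂ w * w : ℂ) ≠ 0 := by
      rw [mul_comm, Complex.mul_conj]; exact_mod_cast hne
    refine ⟨Polynomial.C (1 + starRingEnd ℂ w * w)⁻¹,
      -Polynomial.C ((1 + starRingEnd ℂ w * w)⁻¹ * starRingEnd ℂ w), ?_⟩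
    have h1 : Polynomial.C (1 + starRingEnd ℂ w * w)⁻¹ *
        (1 + Polynomial.C (starRingEnd ℂ w) * Polynomial.C w) = 1 := by
      rw [← Polynomial.C_mul, ← Polynomial.C_1, ← Polynomial.C_add, ← Polynomial.C_mul,
        inv_mul_cancel₀ hne']
    rw [Polynomial.C_mul]
    linear_combination h1
  obtain ⟨k, hk⟩ := hcop.dvd_of_dvd_mul_left (hg ▸ hdvd)
  set q := Polynomial.C Complex.I * ((Polynomial.X - Polynomial.C w) *
      (1 + Polynomial.C (starRingEnd ℂ w) * Polynomial.X)) with hq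
  have hqa : IsAntipodal 1 q := isAntipodal_quadratic w
  have hI : Polynomial.C Complex.I * Polynomial.C Complex.I = -1 := by
    rw [← Polynomial.C_mul, Complex.I_mul_I]; simp
  have hfac : f = q * (-Polynomial.C Complex.I * k) := by
    rw [hg, hk, hq]
    linear_combination ((Polynomial.X - Polynomial.C w) *
      (1 + Polynomial.C (starRingEnd ℂ w) * Polynomial.X) * k) * hI
  generalize -Polynomial.C Complex.I * k = k' at hfac
  have hq0 : q ≠ 0 := by rintro h; simp [hfac, h] at hf0
  have hk0 : k' ≠ 0 := by rintro h; simp [hfac, h] at hf0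
  have hkd : k'.natDegree ≤ 2 * n := by
    have hsum := Polynomial.natDegree_mul hq0 hk0
    rw [← hfac] at hsum
    rcases eq_or_ne w 0 with rfl | hw0
    · have h1 : q.natDegree = 1 := by
        rw [hq]; simp
      have := htop (by simp [Polynomial.coeff_zero_eq_eval_zero, hw.eq_zero])
      omega
    · have h2 : 2 ≤ q.natDegree := by
        apply Polynomial.le_natDegree_of_ne_zero
        rw [hqa.coeff_eq le_rfl]
        simp [hq, Polynomial.coeff_zero_eq_eval_zero, hw0]
      have := hf.natDegree_le
      omega
  refine ⟨q, k', hqa, ⟨hkd, ?_⟩, hfac⟩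
  have h := antipodal_mul hqa.natDegree_le hkd
  rw [← hfac, show 2 * 1 + 2 * n = 2 * (n + 1) by ring, hf.antipodal_eq, hqa.antipodal_eq] at h
  exact (mul_left_cancel₀ hq0 (hfac.symm.trans h)).symm

theorem IsAntipodal.exists_eq_mul_of_four {f : Polynomial ℂ} (hf : IsAntipodal 4 f) :
    ∃ g h, IsAntipodal 2 g ∧ IsAntipodal 2 h ∧ f = g * h := by
  obtain ⟨q₁, f₁, hq₁, hf₁, rfl⟩ := hf.exists_eq_mul
  obtain ⟨q₂, f₂, hq₂, hf₂, rfl⟩ := hf₁.exists_eq_mul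
  exact ⟨q₁ * q₂, f₂, hq₁.mul hq₂, hf₂, by ring⟩

theorem IsAntipodal.coeffs_of_two {f : Polynomial ℂ} (hf : IsAntipodal 2 f) :
    f.coeff 4 = starRingEnd ℂ (f.coeff 0) ∧ f.coeff 3 = -starRingEnd ℂ (f.coeff 1) ∧
      (f.coeff 2).im = 0 := by
  have h4 := hf.coeff_eq (k := 4) (by norm_num)
  have h3 := hf.coeff_eq (k := 3) (by norm_num)
  have h2 := congrArg Complex.im (hf.coeff_eq (k := 2) (by norm_num))
  norm_num at h2 h3 h4
  exact ⟨h4, h3, by linarith⟩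

theorem exists_antipodal_factorization_coeffs (a₀ a₁ a₂ a₃ : ℂ) (r : ℝ) :
    ∃ (b₀ b₁ d₀ d₁ : ℂ) (b₂ d₂ : ℝ),
      a₀ = b₀ * d₀ ∧ a₁ = b₀ * d₁ + b₁ * d₀ ∧ a₂ = b₀ * d₂ + b₁ * d₁ + b₂ * d₀ ∧
      a₃ = -b₀ * starRingEnd ℂ d₁ + b₁ * d₂ + b₂ * d₁ - starRingEnd ℂ b₁ * d₀ ∧
      (r : ℂ) = b₀ * starRingEnd ℂ d₀ - b₁ * starRingEnd ℂ d₁ + b₂ * d₂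
        - starRingEnd ℂ b₁ * d₁ + starRingEnd ℂ b₀ * d₀ := by
  let f : Polynomial ℂ := ∑ k : Fin 9, Polynomial.C
    (![a₀, a₁, a₂, a₃, r, -starRingEnd ℂ a₃, starRingEnd ℂ a₂, -starRingEnd ℂ a₁,
      starRingEnd ℂ a₀] k) * Polynomial.X ^ (k : ℕ)
  have hcoeff : ∀ k, f.coeff k = ∑ j : Fin 9, if k = j then
      (![a₀, a₁, a₂, a₃, (r : ℂ), -starRingEnd ℂ a₃, starRingEnd ℂ a₂, -starRingEnd ℂ a₁,
        starRingEnd ℂ a₀] j) else 0 := by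
    intro k
    simp only [f, Polynomial.finsetSum_coeff, Polynomial.coeff_C_mul_X_pow]
  have hf : IsAntipodal 4 f := by
    refine isAntipodal_of_coeff ?_ fun k hk => ?_
    · refine Polynomial.natDegree_sum_le_of_forall_le _ _ fun j _ => ?_
      refine (Polynomial.natDegree_C_mul_X_pow_le _ _).trans ?_
      omega
    · rw [hcoeff, hcoeff]
      interval_cases k <;> simp [Fin.sum_univ_succ] <;> ring
  obtain ⟨g, h, hg, hh, hgh⟩ := hf.exists_eq_mul_of_four
  obtain ⟨g4, g3, g2⟩ := hg.coeffs_of_two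
  obtain ⟨h4, h3, h2⟩ := hh.coeffs_of_two
  have hg2 : g.coeff 2 = ((g.coeff 2).re : ℂ) := Complex.ext (by simp) (by simpa using g2)
  have hh2 : h.coeff 2 = ((h.coeff 2).re : ℂ) := Complex.ext (by simp) (by simpa using h2)
  have key : ∀ k, f.coeff k = ∑ x ∈ Finset.HasAntidiagonal.antidiagonal k, g.coeff x.1 * h.coeff x.2 := by
    intro k; rw [hgh, Polynomial.coeff_mul]
  refine ⟨g.coeff 0, g.coeff 1, h.coeff 0, h.coeff 1, (g.coeff 2).re, (h.coeff 2).re,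
    ?_, ?_, ?_, ?_, ?_⟩
  · simpa [hcoeff, Fin.sum_univ_succ] using key 0
  · simpa [hcoeff, Fin.sum_univ_succ, Finset.Nat.antidiagonal_succ] using key 1
  · have := key 2
    simp [hcoeff, Fin.sum_univ_succ, Finset.Nat.antidiagonal_succ] at this
    rw [← hg2, ← hh2, this]; ring
  · have := key 3
    simp [hcoeff, Fin.sum_univ_succ, Finset.Nat.antidiagonal_succ] at this
    rw [← hg2, ← hh2, this, g3, h3]; ring
  · have := key 4
    simp [hcoeff, Fin.sum_univ_succ, Finset.Nat.antidiagonal_succ] at this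
    rw [← hg2, ← hh2, this, g3, h3, g4, h4]; ring

theorem MvPolynomial.IsHomogeneous.exists_ternary_quartic {R : Type*} [CommSemiring R]
    {p : MvPolynomial (Fin 3) R} (hp : p.IsHomogeneous 4) :
    ∃ c : (Fin 3 → ℕ) → R, p = ∑ d ∈ Finset.Nat.antidiagonalTuple 3 4,
      C (c d) * (X 0 ^ d 0 * X 1 ^ d 1 * X 2 ^ d 2) := by
  refine ⟨fun d => p.coeff (Finsupp.equivFunOnFinite.symm d), ?_⟩
  have hsum : ∑ d ∈ (Finset.Nat.antidiagonalTuple 3 4).map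
      Finsupp.equivFunOnFinite.symm.toEmbedding, monomial d (p.coeff d) = p := by
    conv_rhs => rw [← p.support_sum_monomial_coeff]
    symm
    refine Finset.sum_subset (fun d hd => ?_) fun d _ hd => ?_
    · have h := hp (MvPolynomial.mem_support_iff.mp hd)
      rw [Finsupp.weight_apply, Finsupp.sum_fintype _ _ (by simp)] at h
      refine Finset.mem_map.mpr ⟨d, Finset.Nat.mem_antidiagonalTuple.mpr ?_, by simp⟩
      simpa using h
    · simp [MvPolynomial.notMem_support_iff.mp hd]
  rw [Finset.sum_map] at hsum
  conv_lhs => rw [← hsum]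
  refine Finset.sum_congr rfl fun d _ => ?_
  rw [monomial_eq, Finsupp.prod_fintype _ _ (by simp), Fin.prod_univ_three]
  rfl

/-- The traceless symmetric matrix whose quadratic form restricts to the null curve
`t ↦ (1 - t ^ 2, I * (1 + t ^ 2), 2 * t)` as the antipodal quartic with leading coefficients
`b₀, b₁, b₂`. -/
noncomputable def deviator (b₀ b₁ : ℂ) (b₂ : ℝ) : Matrix (Fin 3) (Fin 3) ℝ :=
  !![b₀.re / 2 - b₂ / 12, b₀.im / 2, b₁.re / 4;
     b₀.im / 2, -b₀.re / 2 - b₂ / 12, b₁.im / 4;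
     b₁.re / 4, b₁.im / 4, b₂ / 6]

theorem isSymm_deviator (b₀ b₁ : ℂ) (b₂ : ℝ) : (deviator b₀ b₁ b₂).IsSymm := by
  ext i j
  fin_cases i <;> fin_cases j <;> rfl

theorem trace_deviator (b₀ b₁ : ℂ) (b₂ : ℝ) : (deviator b₀ b₁ b₂).trace = 0 := by
  simp [deviator, Matrix.trace_fin_three]
  ring

/-- **Harmonic factorization in 3D.** Every harmonic homogeneous polynomial of degree 4 on ℝ³
is the harmonic product of two second-order deviators. -/
theorem harmonic_factorization_deg4 (p : MvPolynomial (Fin 3) ℝ)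
    (hp : p.IsHomogeneous 4) (hharm : lap3 p = 0) :
    ∃ h₁ h₂ : Matrix (Fin 3) (Fin 3) ℝ,
      h₁.IsSymm ∧ h₂.IsSymm ∧ h₁.trace = 0 ∧ h₂.trace = 0 ∧
      ∀ x : Fin 3 → ℝ,
        eval x p = (x ⬝ᵥ h₁.mulVec x) * (x ⬝ᵥ h₂.mulVec x)
          - 2 / 7 * (∑ i, x i ^ 2) * (x ⬝ᵥ (h₁ * h₂ + h₂ * h₁).mulVec x)
          + 2 / 35 * (h₁ * h₂).trace * (∑ i, x i ^ 2) ^ 2 := by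
  obtain ⟨c, hc⟩ := hp.exists_ternary_quartic
  have hset : Finset.Nat.antidiagonalTuple 3 4 =
      {![0, 0, 4], ![0, 1, 3], ![0, 2, 2], ![0, 3, 1], ![0, 4, 0], ![1, 0, 3], ![1, 1, 2],
        ![1, 2, 1], ![1, 3, 0], ![2, 0, 2], ![2, 1, 1], ![2, 2, 0], ![3, 0, 1], ![3, 1, 0],
        ![4, 0, 0]} := by decide
  rw [hset] at hc
  repeat rw [Finset.sum_insert (by decide)] at hc
  rw [Finset.sum_singleton] at hc
  generalize c ![0, 0, 4] = c004, c ![0, 1, 3] = c013, c ![0, 2, 2] = c022,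
    c ![0, 3, 1] = c031, c ![0, 4, 0] = c040, c ![1, 0, 3] = c103, c ![1, 1, 2] = c112,
    c ![1, 2, 1] = c121, c ![1, 3, 0] = c130, c ![2, 0, 2] = c202, c ![2, 1, 1] = c211,
    c ![2, 2, 0] = c220, c ![3, 0, 1] = c301, c ![3, 1, 0] = c310, c ![4, 0, 0] = c400 at hc
  simp at hc
  have hlap : ∀ x : Fin 3 → ℝ,
      (12 * c400 + 2 * c220 + 2 * c202) * x 0 ^ 2 + (12 * c040 + 2 * c220 + 2 * c022) * x 1 ^ 2
      + (12 * c004 + 2 * c202 + 2 * c022) * x 2 ^ 2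
      + (6 * c310 + 6 * c130 + 2 * c112) * (x 0 * x 1)
      + (6 * c301 + 6 * c103 + 2 * c121) * (x 0 * x 2)
      + (6 * c031 + 6 * c013 + 2 * c211) * (x 1 * x 2) = 0 := by
    intro x
    have h := congrArg (eval x) hharm
    have hnum (i : Fin 3) (n : ℕ) [n.AtLeastTwo] :
        pderiv i (OfNat.ofNat n : MvPolynomial (Fin 3) ℝ) = 0 := Derivation.map_natCast _ n
    simp [hc, lap3, hnum, Fin.sum_univ_three, pderiv_X, Derivation.leibniz_pow] at h
    linear_combination h
  have l0 := hlap ![1, 0, 0]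
  have l1 := hlap ![0, 1, 0]
  have l2 := hlap ![0, 0, 1]
  have l01 := hlap ![1, 1, 0]
  have l02 := hlap ![1, 0, 1]
  have l12 := hlap ![0, 1, 1]
  simp at l0 l1 l2 l01 l02 l12
  obtain ⟨b₀, b₁, d₀, d₁, b₂, d₂, e0, e1, e2, e3, e4⟩ := exists_antipodal_factorization_coeffs
    ⟨c040 - c220 + c400, c310 - c130⟩ ⟨2 * c301 - 2 * c121, 2 * c211 - 2 * c031⟩
    ⟨4 * c040 - 4 * c022 + 4 * c202 - 4 * c400, 4 * c112 - 2 * c130 - 2 * c310⟩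
    ⟨8 * c103 - 2 * c121 - 6 * c301, 8 * c013 - 6 * c031 - 2 * c211⟩
    (16 * c004 - 8 * c022 + 6 * c040 - 8 * c202 + 2 * c220 + 6 * c400)
  refine ⟨deviator b₀ b₁ b₂, deviator d₀ d₁ d₂, isSymm_deviator _ _ _, isSymm_deviator _ _ _,
    trace_deviator _ _ _, trace_deviator _ _ _, fun x => ?_⟩
  rw [Complex.ext_iff] at e0 e1 e2 e3 e4
  obtain ⟨r0, i0⟩ := e0
  obtain ⟨r1, i1⟩ := e1
  obtain ⟨r2, i2⟩ := e2
  obtain ⟨r3, i3⟩ := e3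
  obtain ⟨r4, -⟩ := e4
  simp at r0 i0 r1 i1 r2 i2 r3 i3 r4
  simp [hc, deviator, Matrix.trace_fin_three, Fin.sum_univ_three, dotProduct, Matrix.mulVec]
  linear_combination
    (1 / 8 * x 1 ^ 4 - 3 / 4 * x 0 ^ 2 * x 1 ^ 2 + 1 / 8 * x 0 ^ 4) * r0 +
    (-1 / 2 * x 0 * x 1 ^ 3 + 1 / 2 * x 0 ^ 3 * x 1) * i0 +
    (-3 / 8 * x 0 * x 1 ^ 2 * x 2 + 1 / 8 * x 0 ^ 3 * x 2) * r1 +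
    (-1 / 8 * x 1 ^ 3 * x 2 + 3 / 8 * x 0 ^ 2 * x 1 * x 2) * i1 +
    (-3 / 28 * x 1 ^ 2 * x 2 ^ 2 + 1 / 56 * x 1 ^ 4 + 3 / 28 * x 0 ^ 2 * x 2 ^ 2 - 1 / 56 * x
      0 ^ 4) * r2 +
    (3 / 14 * x 0 * x 1 * x 2 ^ 2 - 1 / 28 * x 0 * x 1 ^ 3 - 1 / 28 * x 0 ^ 3 * x 1) * i2 +
    (1 / 14 * x 0 * x 2 ^ 3 - 3 / 56 * x 0 * x 1 ^ 2 * x 2 - 3 / 56 * x 0 ^ 3 * x 2) * r3 +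
    (1 / 14 * x 1 * x 2 ^ 3 - 3 / 56 * x 1 ^ 3 * x 2 - 3 / 56 * x 0 ^ 2 * x 1 * x 2) * i3 +
    (1 / 70 * x 2 ^ 4 - 3 / 70 * x 1 ^ 2 * x 2 ^ 2 + 3 / 560 * x 1 ^ 4 - 3 / 70 * x 0 ^ 2 * x
      2 ^ 2 + 3 / 280 * x 0 ^ 2 * x 1 ^ 2 + 3 / 560 * x 0 ^ 4) * r4 +
    (-1 / 140 * x 2 ^ 4 - 1 / 70 * x 1 ^ 2 * x 2 ^ 2 - 1 / 140 * x 1 ^ 4 - 1 / 14 * x 0 * x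
      2 ^ 3 - 1 / 14 * x 0 * x 1 * x 2 ^ 2 - 1 / 14 * x 0 * x 1 ^ 2 * x 2 - 1 / 14 * x 0 * x
      1 ^ 3 + 2 / 35 * x 0 ^ 2 * x 2 ^ 2 + 2 / 35 * x 0 ^ 2 * x 1 ^ 2 - 1 / 14 * x 0 ^ 3 * x 2 -
      1 / 14 * x 0 ^ 3 * x 1 + 9 / 140 * x 0 ^ 4) * l0 +
    (-1 / 140 * x 2 ^ 4 - 1 / 14 * x 1 * x 2 ^ 3 + 2 / 35 * x 1 ^ 2 * x 2 ^ 2 - 1 / 14 * x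
      1 ^ 3 * x 2 + 9 / 140 * x 1 ^ 4 - 1 / 14 * x 0 * x 1 * x 2 ^ 2 - 1 / 14 * x 0 * x 1 ^ 3 -
      1 / 70 * x 0 ^ 2 * x 2 ^ 2 - 1 / 14 * x 0 ^ 2 * x 1 * x 2 + 2 / 35 * x 0 ^ 2 * x 1 ^ 2 -
      1 / 14 * x 0 ^ 3 * x 1 - 1 / 140 * x 0 ^ 4) * l1 +
    (9 / 140 * x 2 ^ 4 - 1 / 14 * x 1 * x 2 ^ 3 + 2 / 35 * x 1 ^ 2 * x 2 ^ 2 - 1 / 14 * x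
      1 ^ 3 * x 2 - 1 / 140 * x 1 ^ 4 - 1 / 14 * x 0 * x 2 ^ 3 - 1 / 14 * x 0 * x 1 ^ 2 * x 2 +
      2 / 35 * x 0 ^ 2 * x 2 ^ 2 - 1 / 14 * x 0 ^ 2 * x 1 * x 2 - 1 / 70 * x 0 ^ 2 * x 1 ^ 2 -
      1 / 14 * x 0 ^ 3 * x 2 - 1 / 140 * x 0 ^ 4) * l2 +
    (1 / 14 * x 0 * x 1 * x 2 ^ 2 + 1 / 14 * x 0 * x 1 ^ 3 + 1 / 14 * x 0 ^ 3 * x 1) * l01 +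
    (1 / 14 * x 0 * x 2 ^ 3 + 1 / 14 * x 0 * x 1 ^ 2 * x 2 + 1 / 14 * x 0 ^ 3 * x 2) * l02 +
    (1 / 14 * x 1 * x 2 ^ 3 + 1 / 14 * x 1 ^ 3 * x 2 + 1 / 14 * x 0 ^ 2 * x 1 * x 2) * l12
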